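/- arXiv:1703.07464 — 6 statements merged into one kernel-verified Lean document; each statement's English description precedes it below -/
import Mathlib

section
/- Let x, y, z, p_y, p_z be vectors in ℝ^d and ε ≥ 0 with ‖y − p_y‖ ≤ ε and ‖z − p_z‖ ≤ ε. Then H(‖x − y‖ − ‖x − z‖) ≤ H(‖x − p_y‖ − ‖x − p_z‖) + 𝟙[|‖x − p_y‖ − ‖x − p_z‖| ≤ 2ε], where 𝟙[·] is the indicator function. That is, the ranking loss on a triplet is bounded by the ranking loss on the proxy triplet plus the indicator that the proxy distances are within 2ε of each other. -/
/-- The Heaviside step function: `H t = 1` if `t > 0` and `0` otherwise. -/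
noncomputable def H (t : ℝ) : ℝ := if 0 < t then 1 else 0

/-- For `x, y, z, p_y, p_z ∈ ℝ^d` and `ε ≥ 0` with `‖y − p_y‖ ≤ ε` and
`‖z − p_z‖ ≤ ε`, the ranking loss on the triplet is bounded by the ranking loss on
the proxy triplet plus the indicator that the proxy distances are within `2ε`:
`H(‖x − y‖ − ‖x − z‖) ≤ H(‖x − p_y‖ − ‖x − p_z‖) + 𝟙[|‖x − p_y‖ − ‖x − p_z‖| ≤ 2ε]`. -/
theorem stmt_3 (d : ℕ) (x y z py pz : EuclideanSpace ℝ (Fin d)) (ε : ℝ) (hε : 0 ≤ ε)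
    (hy : ‖y - py‖ ≤ ε) (hz : ‖z - pz‖ ≤ ε) :
    H (‖x - y‖ - ‖x - z‖) ≤
      H (‖x - py‖ - ‖x - pz‖) +
        (if |‖x - py‖ - ‖x - pz‖| ≤ 2 * ε then (1 : ℝ) else 0) := by
  have h₁ : ‖x - y‖ ≤ ‖x - py‖ + ‖y - py‖ := by
    simpa only [norm_sub_rev py y] using norm_sub_le_norm_sub_add_norm_sub x py y
  have h₂ : ‖x - pz‖ ≤ ‖x - z‖ + ‖z - pz‖ := norm_sub_le_norm_sub_add_norm_sub x z pz
  unfold H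
  split_ifs with hxyz hp hclose hclose <;> norm_num
  exact hclose (abs_le.mpr ⟨by linarith, by linarith⟩)
end

section
/- Let D be a finite nonempty set of triplets (x, y, z) of vectors in ℝ^d, let p assign to each point its proxy in ℝ^d, and let ε ≥ 0 satisfy ‖v − p(v)‖ ≤ ε for every point v appearing as a positive or negative in D. Then the average ranking loss satisfies (1/|D|) Σ_{(x,y,z)∈D} H(‖x − y‖ − ‖x − z‖) ≤ (1/|D|) Σ_{(x,y,z)∈D} H(‖x − p(y)‖ − ‖x − p(z)‖) + (1/|D|) · |{(x,y,z) ∈ D : |‖x − p(y)‖ − ‖x − p(z)‖| ≤ 2ε}|. -/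
/-- Perturbing the argument of `H` by at most `δ` can only raise its value when the perturbed
argument lies within `δ` of zero. -/
theorem H_le_H_add_indicator {a b δ : ℝ} (h : |a - b| ≤ δ) :
    H a ≤ H b + if |b| ≤ δ then 1 else 0 := by
  have hab := abs_le.mp h
  unfold H
  split_ifs with ha hb hδ hδ <;> try norm_num
  exact hδ (abs_le.mpr ⟨by linarith, by linarith⟩)

/-- Moving `y` and `z` by at most `ε` changes the distance gap from `x` by at most `2 * ε`. -/
theorem abs_norm_sub_gap_le {E : Type*} [SeminormedAddCommGroup E] {x y z y' z' : E} {ε : ℝ}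
    (hy : ‖y - y'‖ ≤ ε) (hz : ‖z - z'‖ ≤ ε) :
    |(‖x - y‖ - ‖x - z‖) - (‖x - y'‖ - ‖x - z'‖)| ≤ 2 * ε := by
  have key (v w : E) (hvw : ‖v - w‖ ≤ ε) : |‖x - v‖ - ‖x - w‖| ≤ ε := by
    have := abs_norm_sub_norm_le (x - v) (x - w)
    rw [sub_sub_sub_cancel_left, norm_sub_rev w v] at this
    exact this.trans hvw
  have h₁ := abs_le.mp (key y y' hy)
  have h₂ := abs_le.mp (key z z' hz)
  exact abs_le.mpr ⟨by linarith, by linarith⟩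

/-- For a finite nonempty set `D` of triplets `(x, y, z)` in `ℝ^d`,
a proxy assignment `p`, and `ε ≥ 0` bounding the proxy approximation error of every
positive and negative in `D`, the average ranking loss satisfies
`E[L_Ranking(x;y,z)] ≤ E[L_Ranking(x;p(y),p(z))] + Pr[|d(x,p(y)) − d(x,p(z))| ≤ 2ε]`,
where the expectation/probability is the uniform one over `D`. -/
theorem stmt_4 (d : ℕ)
    (D : Finset (EuclideanSpace ℝ (Fin d) × EuclideanSpace ℝ (Fin d) × EuclideanSpace ℝ (Fin d)))
    (hD : D.Nonempty)
    (p : EuclideanSpace ℝ (Fin d) → EuclideanSpace ℝ (Fin d))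
    (ε : ℝ) (hε : 0 ≤ ε)
    (happrox : ∀ t ∈ D, ‖t.2.1 - p t.2.1‖ ≤ ε ∧ ‖t.2.2 - p t.2.2‖ ≤ ε) :
    (1 / (D.card : ℝ)) * ∑ t ∈ D, H (‖t.1 - t.2.1‖ - ‖t.1 - t.2.2‖) ≤
      (1 / (D.card : ℝ)) * ∑ t ∈ D, H (‖t.1 - p t.2.1‖ - ‖t.1 - p t.2.2‖) +
        (1 / (D.card : ℝ)) *
          ((D.filter (fun t => |‖t.1 - p t.2.1‖ - ‖t.1 - p t.2.2‖| ≤ 2 * ε)).card : ℝ) := by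
  rw [← mul_add, Finset.card_filter, Nat.cast_sum, ← Finset.sum_add_distrib]
  gcongr with t ht
  obtain ⟨hy, hz⟩ := happrox t ht
  simpa using H_le_H_add_indicator (abs_norm_sub_gap_le (x := t.1) hy hz)
end

section
/- Let x, y, p_y be unit vectors in ℝ^d, let Z be a finite nonempty set of unit vectors in ℝ^d with a unit-vector proxy p_z for each z ∈ Z, and let ε ≥ 0 satisfy ‖y − p_y‖ ≤ √ε and ‖z − p_z‖ ≤ √ε for all z ∈ Z. Then L_NCA(x, y, Z) ≤ L_NCA(x, p_y, p_Z) + 2√ε, where p_Z = {p_z : z ∈ Z} (counted with multiplicity). -/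
/-- The NCA loss of an anchor `x`, positive `y`, and finite set of negatives given by
the image (with multiplicity) of `Z` under `f`:
`L_NCA(x, y, f(Z)) = −log( exp(−½‖x − y‖²) / Σ_{z∈Z} exp(−½‖x − f z‖²) )`. -/
noncomputable def LNCA {d : ℕ} (x y : EuclideanSpace ℝ (Fin d))
    (Z : Finset (EuclideanSpace ℝ (Fin d)))
    (f : EuclideanSpace ℝ (Fin d) → EuclideanSpace ℝ (Fin d)) : ℝ :=
  -Real.log
    (Real.exp (-(1 / 2) * ‖x - y‖ ^ 2) / ∑ z ∈ Z, Real.exp (-(1 / 2) * ‖x - f z‖ ^ 2))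

/-- For a unit vector `x`, half the squared distance from `x` is `1`-Lipschitz on the unit
sphere. -/
theorem abs_half_norm_sub_sq_sub_le {E : Type*} [NormedAddCommGroup E] [InnerProductSpace ℝ E]
    {x a b : E} (hx : ‖x‖ = 1) (ha : ‖a‖ = 1) (hb : ‖b‖ = 1) :
    |1 / 2 * ‖x - a‖ ^ 2 - 1 / 2 * ‖x - b‖ ^ 2| ≤ ‖a - b‖ := by
  have h : 1 / 2 * ‖x - a‖ ^ 2 - 1 / 2 * ‖x - b‖ ^ 2 = -inner ℝ x (a - b) := by
    rw [norm_sub_sq_real, norm_sub_sq_real, inner_sub_right, ha, hb]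
    ring
  rw [h, abs_neg]
  simpa [hx] using abs_real_inner_le_norm x (a - b)

theorem LNCA_eq {d : ℕ} (x y : EuclideanSpace ℝ (Fin d))
    {Z : Finset (EuclideanSpace ℝ (Fin d))} (hZ : Z.Nonempty)
    (f : EuclideanSpace ℝ (Fin d) → EuclideanSpace ℝ (Fin d)) :
    LNCA x y Z f =
      1 / 2 * ‖x - y‖ ^ 2 + Real.log (∑ z ∈ Z, Real.exp (-(1 / 2) * ‖x - f z‖ ^ 2)) := by
  have hpos : 0 < ∑ z ∈ Z, Real.exp (-(1 / 2) * ‖x - f z‖ ^ 2) :=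
    Finset.sum_pos (fun _ _ => Real.exp_pos _) hZ
  rw [LNCA, Real.log_div (Real.exp_ne_zero _) hpos.ne', Real.log_exp]
  ring

/-- Log-sum-exp grows by at most `c` when every exponent grows by at most `c`. -/
theorem log_sum_exp_le_add {ι : Type*} {s : Finset ι} (hs : s.Nonempty) {u v : ι → ℝ} {c : ℝ}
    (h : ∀ i ∈ s, u i ≤ v i + c) :
    Real.log (∑ i ∈ s, Real.exp (u i)) ≤ Real.log (∑ i ∈ s, Real.exp (v i)) + c := by
  have hu : 0 < ∑ i ∈ s, Real.exp (u i) := Finset.sum_pos (fun _ _ => Real.exp_pos _) hs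
  have hv : 0 < ∑ i ∈ s, Real.exp (v i) := Finset.sum_pos (fun _ _ => Real.exp_pos _) hs
  calc Real.log (∑ i ∈ s, Real.exp (u i))
      ≤ Real.log ((∑ i ∈ s, Real.exp (v i)) * Real.exp c) := by
        refine Real.log_le_log hu ?_
        rw [Finset.sum_mul]
        refine Finset.sum_le_sum fun i hi => ?_
        rw [← Real.exp_add]
        exact Real.exp_le_exp.mpr (h i hi)
    _ = Real.log (∑ i ∈ s, Real.exp (v i)) + c := by
        rw [Real.log_mul hv.ne' (Real.exp_ne_zero _), Real.log_exp]

/-- For unit vectors `x, y, p_y`, a finite nonempty set `Z` of unit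
vectors with a unit-vector proxy `p z` for each `z ∈ Z`, and `ε ≥ 0` with
`‖y − p_y‖ ≤ √ε` and `‖z − p z‖ ≤ √ε` for all `z ∈ Z`, one has
`L_NCA(x, y, Z) ≤ L_NCA(x, p_y, p_Z) + 2√ε` where `p_Z = {p z : z ∈ Z}` counted
with multiplicity. -/
theorem stmt_7 (d : ℕ) (x y py : EuclideanSpace ℝ (Fin d))
    (Z : Finset (EuclideanSpace ℝ (Fin d))) (hZ : Z.Nonempty)
    (p : EuclideanSpace ℝ (Fin d) → EuclideanSpace ℝ (Fin d))
    (ε : ℝ) (hε : 0 ≤ ε)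
    (hx : ‖x‖ = 1) (hy : ‖y‖ = 1) (hpy : ‖py‖ = 1)
    (hz : ∀ z ∈ Z, ‖z‖ = 1) (hpz : ∀ z ∈ Z, ‖p z‖ = 1)
    (hay : ‖y - py‖ ≤ Real.sqrt ε) (haz : ∀ z ∈ Z, ‖z - p z‖ ≤ Real.sqrt ε) :
    LNCA x y Z id ≤ LNCA x py Z p + 2 * Real.sqrt ε := by
  rw [LNCA_eq x y hZ, LNCA_eq x py hZ]
  have hpos := (abs_le.mp (abs_half_norm_sub_sq_sub_le hx hy hpy)).2
  have hneg := log_sum_exp_le_add hZ (u := fun z => -(1 / 2) * ‖x - id z‖ ^ 2)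
    (v := fun z => -(1 / 2) * ‖x - p z‖ ^ 2) (c := Real.sqrt ε) fun z hzZ => by
      have hzp := (abs_le.mp (abs_half_norm_sub_sq_sub_le hx (hz z hzZ) (hpz z hzZ))).1
      have := haz z hzZ
      simp only [id]
      linarith
  linarith
end

section
/- Let x be a vector in ℝ^d with ‖x‖ = N_x, let Z be a finite nonempty index set with vectors p_z ∈ ℝ^d satisfying ‖p_z‖ = N_p for all z ∈ Z, and suppose β := 1/(N_x · N_p) satisfies 0 < β ≤ 1. Then Σ_{z∈Z} exp(⟪x̂, p̂_z⟫) ≤ |Z|^{1−β} · ( Σ_{z∈Z} exp(⟪x, p_z⟫) )^β, where x̂ = x/‖x‖ and p̂_z = p_z/‖p_z‖ denote the unit-normalized vectors. -/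
open RealInnerProductSpace

/-- Power-mean inequality for an exponent `β ∈ [0, 1]`. -/
theorem sum_rpow_le_card_rpow_mul_rpow_sum {ι : Type*} (s : Finset ι) (hs : s.Nonempty)
    (a : ι → ℝ) (ha : ∀ i ∈ s, 0 ≤ a i) {β : ℝ} (hβ0 : 0 ≤ β) (hβ1 : β ≤ 1) :
    ∑ i ∈ s, a i ^ β ≤ (s.card : ℝ) ^ (1 - β) * (∑ i ∈ s, a i) ^ β := by
  have hcard : (0 : ℝ) < s.card := by exact_mod_cast hs.card_pos
  have hJ := (Real.concaveOn_rpow hβ0 hβ1).le_map_sum (t := s)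
    (w := fun _ => (s.card : ℝ)⁻¹) (p := a) (fun _ _ => by positivity)
    (by simp [hcard.ne']) ha
  simp only [smul_eq_mul, ← Finset.mul_sum] at hJ
  rw [Real.mul_rpow (by positivity) (Finset.sum_nonneg ha), inv_mul_le_iff₀ hcard,
    ← mul_assoc, Real.inv_rpow hcard.le, ← div_eq_mul_inv] at hJ
  rwa [Real.rpow_sub hcard, Real.rpow_one]

/-- Let `x ∈ ℝ^d` with `‖x‖ = N_x`, let `Z` be a finite nonempty index
set with vectors `p z ∈ ℝ^d` satisfying `‖p z‖ = N_p` for all `z ∈ Z`, and suppose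
`β := 1/(N_x · N_p)` satisfies `0 < β ≤ 1`. Then
`Σ_{z∈Z} exp(⟪x̂, p̂_z⟫) ≤ |Z|^{1−β} · (Σ_{z∈Z} exp(⟪x, p_z⟫))^β`,
where `x̂ = x/‖x‖` and `p̂_z = p_z/‖p_z‖`. -/
theorem stmt_9 (d : ℕ) {ι : Type*} (x : EuclideanSpace ℝ (Fin d))
    (Z : Finset ι) (hZ : Z.Nonempty) (p : ι → EuclideanSpace ℝ (Fin d))
    (Nx Np : ℝ) (hx : ‖x‖ = Nx) (hp : ∀ z ∈ Z, ‖p z‖ = Np)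
    (β : ℝ) (hβ : β = 1 / (Nx * Np)) (hβ0 : 0 < β) (hβ1 : β ≤ 1) :
    ∑ z ∈ Z, Real.exp ⟪(‖x‖)⁻¹ • x, (‖p z‖)⁻¹ • p z⟫ ≤
      (Z.card : ℝ) ^ (1 - β) * (∑ z ∈ Z, Real.exp ⟪x, p z⟫) ^ β := by
  refine le_of_eq_of_le (Finset.sum_congr rfl fun z hz => ?_)
    (sum_rpow_le_card_rpow_mul_rpow_sum Z hZ (fun z => Real.exp ⟪x, p z⟫)
      (fun _ _ => (Real.exp_pos _).le) hβ0.le hβ1)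
  rw [← Real.exp_mul, real_inner_smul_left, real_inner_smul_right, hx, hp z hz, hβ,
    one_div, mul_inv]
  ring_nf
end

section
/- (Proposition 4.1, proxy bound for the NCA loss.) Let x, y be nonzero vectors in ℝ^d with ‖x‖ = N_x, let Z be a finite nonempty set of nonzero vectors in ℝ^d, let p_y and p_z (for z ∈ Z) be nonzero proxy vectors with ‖p_y‖ = ‖p_z‖ = N_p, and suppose β := 1/(N_x · N_p) satisfies 0 < β ≤ 1. Let ε ≥ 0 satisfy ‖ŷ − p̂_y‖ ≤ √ε and ‖ẑ − p̂_z‖ ≤ √ε for all z ∈ Z, where v̂ = v/‖v‖. Then the NCA loss on unit-normalized points is proxy bounded: L_NCA(x̂, ŷ, Ẑ) ≤ β · L_NCA(x, p_y, p_Z) + (1 − β) · log|Z| + 2√ε, where Ẑ = {ẑ : z ∈ Z} and p_Z = {p_z : z ∈ Z}. -/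
open scoped RealInnerProductSpace

/-- When the positive and all negatives have the same norm, the NCA loss is a softmax loss
in the inner products. -/
lemma LNCA_eq_log_sum_exp_inner {d : ℕ} (x y : EuclideanSpace ℝ (Fin d))
    {Z : Finset (EuclideanSpace ℝ (Fin d))} (hZ : Z.Nonempty)
    {f : EuclideanSpace ℝ (Fin d) → EuclideanSpace ℝ (Fin d)}
    (hf : ∀ z ∈ Z, ‖f z‖ = ‖y‖) :
    LNCA x y Z f = Real.log (∑ z ∈ Z, Real.exp ⟪x, f z⟫) - ⟪x, y⟫ := by
  have hsum : ∑ z ∈ Z, Real.exp (-(1 / 2) * ‖x - f z‖ ^ 2) =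
      Real.exp (-(1 / 2) * (‖x‖ ^ 2 + ‖y‖ ^ 2)) * ∑ z ∈ Z, Real.exp ⟪x, f z⟫ := by
    rw [Finset.mul_sum]
    refine Finset.sum_congr rfl fun z hz => ?_
    rw [← Real.exp_add, norm_sub_sq_real, hf z hz]
    ring_nf
  have hpos : 0 < ∑ z ∈ Z, Real.exp ⟪x, f z⟫ := Finset.sum_pos (fun _ _ => Real.exp_pos _) hZ
  rw [LNCA, hsum, Real.log_div (Real.exp_ne_zero _) (by positivity),
    Real.log_mul (Real.exp_ne_zero _) hpos.ne', Real.log_exp, Real.log_exp, norm_sub_sq_real]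
  ring

/-- Scaling the exponents of a log-sum-exp by `β ∈ (0, 1]`. -/
lemma log_sum_exp_mul_le {ι : Type*} {s : Finset ι} (hs : s.Nonempty) (a : ι → ℝ) {β : ℝ}
    (hβ0 : 0 < β) (hβ1 : β ≤ 1) :
    Real.log (∑ i ∈ s, Real.exp (β * a i)) ≤
      β * Real.log (∑ i ∈ s, Real.exp (a i)) + (1 - β) * Real.log (s.card : ℝ) := by
  have hpow := Real.rpow_sum_le_const_mul_sum_rpow s (fun i => Real.exp (β * a i))
    ((one_le_div hβ0).2 hβ1)
  have hexp (i : ι) : Real.exp (β * a i) ^ (1 / β) = Real.exp (a i) := by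
    rw [← Real.exp_mul]
    field_simp
  simp only [Real.abs_exp, hexp] at hpow
  have hcard : (0 : ℝ) < s.card := by exact_mod_cast hs.card_pos
  have hpos (b : ι → ℝ) : 0 < ∑ i ∈ s, Real.exp (b i) :=
    Finset.sum_pos (fun _ _ => Real.exp_pos _) hs
  have hlog := Real.log_le_log (Real.rpow_pos_of_pos (hpos _) _) hpow
  rw [Real.log_mul (Real.rpow_pos_of_pos hcard _).ne' (hpos _).ne', Real.log_rpow (hpos _),
    Real.log_rpow hcard] at hlog
  have hmul := mul_le_mul_of_nonneg_left hlog hβ0.le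
  have hcancel : β * (1 / β) = 1 := by field_simp
  linear_combination hmul +
    (Real.log s.card - Real.log (∑ i ∈ s, Real.exp (β * a i))) * hcancel

/-- Pairing with a unit vector changes by at most the distance. -/
lemma abs_inner_sub_inner_le {E : Type*} [NormedAddCommGroup E] [InnerProductSpace ℝ E]
    {u : E} (hu : ‖u‖ = 1) (v w : E) : |⟪u, v⟫ - ⟪u, w⟫| ≤ ‖v - w‖ := by
  rw [← inner_sub_right]
  simpa [hu] using abs_real_inner_le_norm u (v - w)

/-- Proposition 4.1, proxy bound for the NCA loss: Let `x, y` be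
nonzero vectors in `ℝ^d` with `‖x‖ = N_x`, let `Z` be a finite nonempty set of
nonzero vectors, let `p_y` and `p z` (for `z ∈ Z`) be nonzero proxies with
`‖p_y‖ = ‖p z‖ = N_p`, suppose `β := 1/(N_x · N_p)` satisfies `0 < β ≤ 1`, and let
`ε ≥ 0` satisfy `‖ŷ − p̂_y‖ ≤ √ε` and `‖ẑ − p̂_z‖ ≤ √ε` for all `z ∈ Z` (with
`v̂ = v/‖v‖`). Then `L_NCA(x̂, ŷ, Ẑ) ≤ β · L_NCA(x, p_y, p_Z) + (1 − β)·log|Z| + 2√ε`. -/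
theorem stmt_11 (d : ℕ) (x y py : EuclideanSpace ℝ (Fin d))
    (Z : Finset (EuclideanSpace ℝ (Fin d))) (hZ : Z.Nonempty)
    (p : EuclideanSpace ℝ (Fin d) → EuclideanSpace ℝ (Fin d))
    (Nx Np : ℝ) (hx0 : x ≠ 0) (hy0 : y ≠ 0) (hz0 : ∀ z ∈ Z, z ≠ 0)
    (hpy0 : py ≠ 0) (hp0 : ∀ z ∈ Z, p z ≠ 0)
    (hx : ‖x‖ = Nx) (hpy : ‖py‖ = Np) (hp : ∀ z ∈ Z, ‖p z‖ = Np)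
    (β : ℝ) (hβ : β = 1 / (Nx * Np)) (hβ0 : 0 < β) (hβ1 : β ≤ 1)
    (ε : ℝ) (hε : 0 ≤ ε)
    (hay : ‖(‖y‖)⁻¹ • y - (‖py‖)⁻¹ • py‖ ≤ Real.sqrt ε)
    (haz : ∀ z ∈ Z, ‖(‖z‖)⁻¹ • z - (‖p z‖)⁻¹ • p z‖ ≤ Real.sqrt ε) :
    LNCA ((‖x‖)⁻¹ • x) ((‖y‖)⁻¹ • y) Z (fun z => (‖z‖)⁻¹ • z) ≤
      β * LNCA x py Z p + (1 - β) * Real.log (Z.card : ℝ) + 2 * Real.sqrt ε := by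
  have hunit {v : EuclideanSpace ℝ (Fin d)} (hv : v ≠ 0) : ‖(‖v‖)⁻¹ • v‖ = 1 :=
    norm_smul_inv_norm (𝕜 := ℝ) hv
  have hscale {q : EuclideanSpace ℝ (Fin d)} (hq : ‖q‖ = Np) :
      ⟪(‖x‖)⁻¹ • x, (‖q‖)⁻¹ • q⟫ = β * ⟪x, q⟫ := by
    rw [real_inner_smul_left, real_inner_smul_right, hx, hq, hβ, one_div, mul_inv, mul_assoc]
  have hpos := (abs_le.1 ((abs_inner_sub_inner_le (hunit hx0) _ _).trans hay)).1
  rw [hscale hpy] at hpos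
  have hneg (z) (hz : z ∈ Z) :
      ⟪(‖x‖)⁻¹ • x, (‖z‖)⁻¹ • z⟫ ≤ Real.sqrt ε + β * ⟪x, p z⟫ := by
    have h := (abs_le.1 ((abs_inner_sub_inner_le (hunit hx0) _ _).trans (haz z hz))).2
    rw [hscale (hp z hz)] at h
    linarith
  have hsum : ∑ z ∈ Z, Real.exp ⟪(‖x‖)⁻¹ • x, (‖z‖)⁻¹ • z⟫ ≤
      Real.exp (Real.sqrt ε) * ∑ z ∈ Z, Real.exp (β * ⟪x, p z⟫) := by
    rw [Finset.mul_sum]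
    refine Finset.sum_le_sum fun z hz => ?_
    rw [← Real.exp_add]
    exact Real.exp_le_exp.2 (hneg z hz)
  have hlog := Real.log_le_log (Finset.sum_pos (fun _ _ => Real.exp_pos _) hZ) hsum
  rw [Real.log_mul (Real.exp_ne_zero _) (Finset.sum_pos (fun _ _ => Real.exp_pos _) hZ).ne',
    Real.log_exp] at hlog
  have hjensen := log_sum_exp_mul_le hZ (fun z => ⟪x, p z⟫) hβ0 hβ1
  rw [LNCA_eq_log_sum_exp_inner _ _ hZ fun z hz => (hunit (hz0 z hz)).trans (hunit hy0).symm,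
    LNCA_eq_log_sum_exp_inner _ _ hZ fun z hz => (hp z hz).trans hpy.symm]
  linarith
end

section
/- (Proposition 4.2, proxy bound for the margin triplet loss.) Let x, y, z be nonzero vectors in ℝ^d with ‖x‖ = N_x, let p_y, p_z be nonzero proxies with ‖p_y‖ = ‖p_z‖ = N_p, suppose α := 1/(N_x · N_p) satisfies 0 < α ≤ 1, let M ≥ 0, and let ε ≥ 0 satisfy ‖ŷ − p̂_y‖ ≤ √ε and ‖ẑ − p̂_z‖ ≤ √ε, where v̂ = v/‖v‖. Then the triplet loss on unit-normalized points is proxy bounded: L_triplet(x̂, ŷ, ẑ) ≤ α · L_triplet(x, p_y, p_z) + (1 − α) · M + 4√ε. -/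
/-- The margin triplet loss with margin `M`:
`L_triplet(x, y, z) = max(0, ‖x − y‖² + M − ‖x − z‖²)`. -/
noncomputable def Ltriplet {d : ℕ} (x y z : EuclideanSpace ℝ (Fin d)) (M : ℝ) : ℝ :=
  max 0 (‖x - y‖ ^ 2 + M - ‖x - z‖ ^ 2)

/-- Squared distances from a common point to two points of equal norm differ only in the
inner-product terms. -/
theorem norm_sub_sq_sub_norm_sub_sq_of_norm_eq {E : Type*} [NormedAddCommGroup E]
    [InnerProductSpace ℝ E] (u : E) {v w : E} (h : ‖v‖ = ‖w‖) :
    ‖u - v‖ ^ 2 - ‖u - w‖ ^ 2 = 2 * (inner ℝ u w - inner ℝ u v) := by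
  rw [norm_sub_sq_real, norm_sub_sq_real, h]
  ring

/-- Inner products with a unit vector are 1-Lipschitz. -/
theorem abs_inner_sub_inner_le_of_norm_eq_one {E : Type*} [NormedAddCommGroup E]
    [InnerProductSpace ℝ E] {u v w : E} {r : ℝ} (hu : ‖u‖ = 1) (h : ‖v - w‖ ≤ r) :
    |inner ℝ u v - inner ℝ u w| ≤ r := by
  rw [← inner_sub_right]
  refine (abs_real_inner_le_norm u (v - w)).trans ?_
  rwa [hu, one_mul]

/-- Proposition 4.2, proxy bound for the margin triplet loss:
Let `x, y, z` be nonzero vectors in `ℝ^d` with `‖x‖ = N_x`, let `p_y, p_z` be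
nonzero proxies with `‖p_y‖ = ‖p_z‖ = N_p`, suppose `α := 1/(N_x · N_p)` satisfies
`0 < α ≤ 1`, let `M ≥ 0`, and let `ε ≥ 0` satisfy `‖ŷ − p̂_y‖ ≤ √ε` and
`‖ẑ − p̂_z‖ ≤ √ε` (with `v̂ = v/‖v‖`). Then
`L_triplet(x̂, ŷ, ẑ) ≤ α · L_triplet(x, p_y, p_z) + (1 − α)·M + 4√ε`. -/
theorem stmt_13 (d : ℕ) (x y z py pz : EuclideanSpace ℝ (Fin d))
    (Nx Np M ε α : ℝ)
    (hx0 : x ≠ 0) (hy0 : y ≠ 0) (hz0 : z ≠ 0) (hpy0 : py ≠ 0) (hpz0 : pz ≠ 0)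
    (hx : ‖x‖ = Nx) (hpy : ‖py‖ = Np) (hpz : ‖pz‖ = Np)
    (hα : α = 1 / (Nx * Np)) (hα0 : 0 < α) (hα1 : α ≤ 1)
    (hM : 0 ≤ M) (hε : 0 ≤ ε)
    (hay : ‖(‖y‖)⁻¹ • y - (‖py‖)⁻¹ • py‖ ≤ Real.sqrt ε)
    (haz : ‖(‖z‖)⁻¹ • z - (‖pz‖)⁻¹ • pz‖ ≤ Real.sqrt ε) :
    Ltriplet ((‖x‖)⁻¹ • x) ((‖y‖)⁻¹ • y) ((‖z‖)⁻¹ • z) M ≤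
      α * Ltriplet x py pz M + (1 - α) * M + 4 * Real.sqrt ε := by
  have hux : ‖(‖x‖)⁻¹ • x‖ = 1 := norm_smul_inv_norm (𝕜 := ℝ) hx0
  have huy : ‖(‖y‖)⁻¹ • y‖ = 1 := norm_smul_inv_norm (𝕜 := ℝ) hy0
  have huz : ‖(‖z‖)⁻¹ • z‖ = 1 := norm_smul_inv_norm (𝕜 := ℝ) hz0
  have hy := abs_le.1 (abs_inner_sub_inner_le_of_norm_eq_one hux hay)
  have hz := abs_le.1 (abs_inner_sub_inner_le_of_norm_eq_one hux haz)
  have scale (p : EuclideanSpace ℝ (Fin d)) (hp : ‖p‖ = Np) :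
      inner ℝ ((‖x‖)⁻¹ • x) ((‖p‖)⁻¹ • p) = α * inner ℝ x p := by
    rw [real_inner_smul_left, real_inner_smul_right, hx, hp, hα, one_div, mul_inv, mul_assoc]
  rw [scale py hpy] at hy
  rw [scale pz hpz] at hz
  have hunit := norm_sub_sq_sub_norm_sub_sq_of_norm_eq ((‖x‖)⁻¹ • x) (huy.trans huz.symm)
  have hproxy := norm_sub_sq_sub_norm_sub_sq_of_norm_eq x (hpy.trans hpz.symm)
  have hs := Real.sqrt_nonneg ε
  have hmargin : 0 ≤ (1 - α) * M := mul_nonneg (sub_nonneg.2 hα1) hM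
  unfold Ltriplet
  apply max_le
  · have hloss := mul_nonneg hα0.le (le_max_left 0 (‖x - py‖ ^ 2 + M - ‖x - pz‖ ^ 2))
    linarith
  · have hloss := mul_le_mul_of_nonneg_left
      (le_max_right 0 (‖x - py‖ ^ 2 + M - ‖x - pz‖ ^ 2)) hα0.le
    have hexpand : α * (‖x - py‖ ^ 2 + M - ‖x - pz‖ ^ 2) =
        α * M + 2 * (α * inner ℝ x pz - α * inner ℝ x py) := by
      linear_combination α * hproxy
    linarith
end
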